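/- arXiv:2107.10613 — 3 statements merged into one kernel-verified Lean document; each statement's English description precedes it below -/
import Mathlib

section
/- Let α, β ∈ (0,1) be irrational. The two-sided Sturmian subshifts (Λ_α, σ_α) and (Λ_β, σ_β) are conjugate if and only if α = β or α = 1 − β. -/
noncomputable section

open Set

/-! ### Sturmian sequences and subshifts -/

/-- The Sturmian coding of a real number `t`: `false` (the symbol `0`) if the fractional
part of `t` lies in `[0, 1 - α)`, and `true` (the symbol `1`) if it lies in `[1 - α, 1)`. -/
def sturmianCode (α t : ℝ) : Bool := decide (1 - α ≤ Int.fract t)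

/-- The one-sided Sturmian sequence with parameter `α` and starting point `t`,
i.e. `i ↦ I_α (R_α^i t)`. -/
def sturmianSeqN (α t : ℝ) : ℕ → Bool := fun i => sturmianCode α (t + i * α)

/-- The one-sided Sturmian subshift `X_α`. -/
def sturmianN (α : ℝ) : Set (ℕ → Bool) := closure {x | ∃ t : ℝ, x = sturmianSeqN α t}

/-- The two-sided Sturmian sequence with parameter `α` and starting point `t`. -/
def sturmianSeqZ (α t : ℝ) : ℤ → Bool := fun i => sturmianCode α (t + i * α)

/-- The two-sided Sturmian subshift `Λ_α`. -/
def sturmianZ (α : ℝ) : Set (ℤ → Bool) := closure {x | ∃ t : ℝ, x = sturmianSeqZ α t}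

/-- The shift on one-sided sequences. -/
def shiftN {A : Type*} (x : ℕ → A) : ℕ → A := fun i => x (i + 1)

/-- The shift on two-sided sequences. -/
def shiftZ {A : Type*} (x : ℤ → A) : ℤ → A := fun i => x (i + 1)

lemma continuous_shiftN {A : Type*} [TopologicalSpace A] :
    Continuous (shiftN (A := A)) := continuous_pi fun i => continuous_apply (i + 1)

lemma continuous_shiftZ {A : Type*} [TopologicalSpace A] :
    Continuous (shiftZ (A := A)) := continuous_pi fun i => continuous_apply (i + 1)

lemma sturmianN_shift_mem {α : ℝ} {x : ℕ → Bool} (hx : x ∈ sturmianN α) :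
    shiftN x ∈ sturmianN α := by
  have h : MapsTo shiftN {x : ℕ → Bool | ∃ t : ℝ, x = sturmianSeqN α t}
      {x : ℕ → Bool | ∃ t : ℝ, x = sturmianSeqN α t} := by
    rintro x ⟨t, rfl⟩
    refine ⟨t + α, ?_⟩
    funext i
    show sturmianCode α (t + (↑(i + 1) : ℝ) * α) = sturmianCode α (t + α + (i : ℝ) * α)
    congr 1
    push_cast
    ring
  exact h.closure continuous_shiftN hx

lemma sturmianZ_shift_mem {α : ℝ} {x : ℤ → Bool} (hx : x ∈ sturmianZ α) :
    shiftZ x ∈ sturmianZ α := by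
  have h : MapsTo shiftZ {x : ℤ → Bool | ∃ t : ℝ, x = sturmianSeqZ α t}
      {x : ℤ → Bool | ∃ t : ℝ, x = sturmianSeqZ α t} := by
    rintro x ⟨t, rfl⟩
    refine ⟨t + α, ?_⟩
    funext i
    show sturmianCode α (t + (↑(i + 1) : ℝ) * α) = sturmianCode α (t + α + (i : ℝ) * α)
    congr 1
    push_cast
    ring
  exact h.closure continuous_shiftZ hx

/-- The shift map `σ_α : X_α → X_α` of the one-sided Sturmian subshift. -/
def sturmianShiftN (α : ℝ) (x : ↥(sturmianN α)) : ↥(sturmianN α) :=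
  ⟨shiftN x.1, sturmianN_shift_mem x.2⟩

/-- The shift map `σ_α : Λ_α → Λ_α` of the two-sided Sturmian subshift. -/
def sturmianShiftZ (α : ℝ) (x : ↥(sturmianZ α)) : ↥(sturmianZ α) :=
  ⟨shiftZ x.1, sturmianZ_shift_mem x.2⟩

/-- The branch point `ω_α` of the one-sided Sturmian subshift (corresponding to `t = α`). -/
def sturmianBranch (α : ℝ) : ℕ → Bool := sturmianSeqN α α

/-- The orbit `orb_α(x) = ⋃_{k,l} σ_α^{-l}(σ_α^k(x))` of a point of `X_α`. -/
def sturmianOrbN (α : ℝ) (x : ℕ → Bool) : Set (ℕ → Bool) :=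
  {y | y ∈ sturmianN α ∧ ∃ k l : ℕ, shiftN^[l] y = shiftN^[k] x}

/-- The forward orbit `orb⁺_α(x) = {σ_α^k(x) : k ∈ ℕ}`. -/
def sturmianOrbPlus (α : ℝ) (x : ℕ → Bool) : Set (ℕ → Bool) :=
  {y | ∃ k : ℕ, y = shiftN^[k] x}

/-- The orbit `{σ^n(x) : n ∈ ℤ}` of a two-sided sequence under the shift:
`σ^n(x) = (i ↦ x (i + n))`. -/
def orbitZ {A : Type*} (x : ℤ → A) : Set (ℤ → A) := {y | ∃ n : ℤ, y = fun i => x (i + n)}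

/-- Equivalence of irrationals: `α ∼ β` iff `β = (aα+b)/(cα+d)` with `ad - bc = ±1`. -/
def IrrationalEquiv (α β : ℝ) : Prop :=
  ∃ a b c d : ℤ, (a * d - b * c = 1 ∨ a * d - b * c = -1) ∧
    β = ((a : ℝ) * α + b) / ((c : ℝ) * α + d)

/-- The subgroup `ℤ + αℤ = {m + nα : m, n ∈ ℤ}` of `ℝ`, as an ordered abelian group with
the order inherited from `ℝ`. -/
def ZplusAZ (α : ℝ) : AddSubgroup ℝ where
  carrier := {x | ∃ m n : ℤ, x = (m : ℝ) + n * α}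
  add_mem' := by
    rintro x y ⟨m, n, rfl⟩ ⟨m', n', rfl⟩
    exact ⟨m + m', n + n', by push_cast; ring⟩
  zero_mem' := ⟨0, 0, by norm_num⟩
  neg_mem' := by
    rintro x ⟨m, n, rfl⟩
    exact ⟨-m, -n, by push_cast; ring⟩

lemma one_mem_ZplusAZ (α : ℝ) : (1 : ℝ) ∈ ZplusAZ α := ⟨1, 0, by norm_num⟩

/-! ### Suspension and flow -/

/-- The relation `(x, s+1) ∼ (σ_α x, s)` generating the suspension of `(Λ_α, σ_α)`. -/
def suspRel (α : ℝ) (p q : ↥(sturmianZ α) × ℝ) : Prop :=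
  ∃ (x : ↥(sturmianZ α)) (s : ℝ), p = (x, s + 1) ∧ q = (sturmianShiftZ α x, s)

/-- The suspension (mapping torus) of the two-sided Sturmian subshift `(Λ_α, σ_α)`:
the quotient of `Λ_α × ℝ` by the equivalence relation generated by `(x,s+1) ∼ (σ_α x, s)`. -/
def Suspension (α : ℝ) : Type := Quot (suspRel α)

instance (α : ℝ) : TopologicalSpace (Suspension α) := by
  unfold Suspension; infer_instance

/-- The flow `φ_{s'}[x,s] = [x, s + s']` on the suspension. -/
def suspFlow (α : ℝ) (s' : ℝ) : Suspension α → Suspension α :=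
  Quot.map (fun p => (p.1, p.2 + s'))
    (by
      rintro p q ⟨x, s, rfl, rfl⟩
      exact ⟨x, s + s', by show (x, s + 1 + s') = (x, s + s' + 1); rw [add_right_comm s 1 s'], rfl⟩)

/-- Flow equivalence of two Sturmian subshifts: a homeomorphism of the suspensions mapping
each flow orbit onto a flow orbit, preserving the forward direction of the flow. -/
def SturmianFlowEquiv (α β : ℝ) : Prop :=
  ∃ h : Suspension α ≃ₜ Suspension β, ∀ u : Suspension α, ∃ c : ℝ → ℝ,
    StrictMono c ∧ Function.Surjective c ∧
      ∀ s : ℝ, h (suspFlow α s u) = suspFlow β (c s) (h u)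

/-! ### Words and pasts -/

/-- Prepend a letter to a one-sided sequence. -/
def consSeq {A : Type*} (a : A) (x : ℕ → A) : ℕ → A := fun i => if i = 0 then a else x (i - 1)

/-- Prepend a finite word (a list) to a one-sided sequence: `μx`. -/
def wordCat {A : Type*} (μ : List A) (x : ℕ → A) : ℕ → A := μ.foldr consSeq x

/-- The set `P_l(x)` of `l`-pasts of `x` relative to a subshift `X`. -/
def past {A : Type*} (X : Set (ℕ → A)) (l : ℕ) (x : ℕ → A) : Set (List A) :=
  {μ | μ.length = l ∧ wordCat μ x ∈ X}

/-- `x` is isolated in `l`-past equivalence in `X`. -/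
def IsolatedInPast {A : Type*} (X : Set (ℕ → A)) (l : ℕ) (x : ℕ → A) : Prop :=
  ∀ y ∈ X, past X l y = past X l x → y = x


lemma shiftN_consSeq {A : Type*} (a : A) (x : ℕ → A) : shiftN (consSeq a x) = x := by
  funext i; simp [shiftN, consSeq]

lemma consSeq_shiftN {A : Type*} (x : ℕ → A) : consSeq (x 0) (shiftN x) = x := by
  funext i; cases i <;> simp [consSeq, shiftN]

lemma shiftN_iterate_apply {A : Type*} (x : ℕ → A) (k i : ℕ) : shiftN^[k] x i = x (i + k) := by
  induction k generalizing x i with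
  | zero => rfl
  | succ k ih =>
    rw [Function.iterate_succ_apply, ih (shiftN x) i]
    show x (i + k + 1) = x (i + (k + 1))
    ring_nf

lemma shiftN_iterate_wordCat {A : Type*} (μ : List A) (x : ℕ → A) :
    shiftN^[μ.length] (wordCat μ x) = x := by
  induction μ with
  | nil => rfl
  | cons a μ ih =>
    show shiftN^[μ.length + 1] (consSeq a (wordCat μ x)) = x
    rw [Function.iterate_succ_apply, shiftN_consSeq, ih]

lemma wordCat_append {A : Type*} (μ ν : List A) (x : ℕ → A) :
    wordCat (μ ++ ν) x = wordCat μ (wordCat ν x) := by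
  simp [wordCat, List.foldr_append]

lemma shiftN_mem_of_image {A : Type*} {X : Set (ℕ → A)} (hX : shiftN '' X = X)
    {x : ℕ → A} (hx : x ∈ X) : shiftN x ∈ X := by
  rw [← hX]; exact ⟨x, hx, rfl⟩

lemma shiftN_iterate_mem_of_image {A : Type*} {X : Set (ℕ → A)} (hX : shiftN '' X = X)
    {x : ℕ → A} (hx : x ∈ X) (k : ℕ) : shiftN^[k] x ∈ X := by
  induction k generalizing x with
  | zero => exact hx
  | succ k ih =>
    rw [Function.iterate_succ_apply]
    exact ih (shiftN_mem_of_image hX hx)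

lemma exists_word_extension {A : Type*} {X : Set (ℕ → A)} (hX : shiftN '' X = X)
    {z : ℕ → A} (hz : z ∈ X) (d : ℕ) : ∃ ν : List A, ν.length = d ∧ wordCat ν z ∈ X := by
  induction d with
  | zero => exact ⟨[], rfl, hz⟩
  | succ d ih =>
    obtain ⟨ν, hlen, hν⟩ := ih
    have : wordCat ν z ∈ shiftN '' X := by rw [hX]; exact hν
    obtain ⟨w, hw, hweq⟩ := this
    refine ⟨w 0 :: ν, by simp [hlen], ?_⟩
    show consSeq (w 0) (wordCat ν z) ∈ X
    rw [← hweq, consSeq_shiftN]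
    exact hw

lemma past_mono {A : Type*} {X : Set (ℕ → A)} (hX : shiftN '' X = X) {m l : ℕ} (hml : m ≤ l)
    {z z' : ℕ → A} (h : past X l z = past X l z') : past X m z = past X m z' := by
  have key : ∀ w w' : ℕ → A, past X l w ⊆ past X l w' → past X m w ⊆ past X m w' := by
    intro w w' hsub μ hμ
    obtain ⟨hlen, hmem⟩ := hμ
    obtain ⟨ν, hνlen, hνmem⟩ := exists_word_extension hX hmem (l - m)
    rw [← wordCat_append] at hνmem
    have hin : ν ++ μ ∈ past X l w := ⟨by simp [hνlen, hlen]; omega, hνmem⟩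
    have hout := hsub hin
    obtain ⟨-, hmem'⟩ := hout
    rw [wordCat_append] at hmem'
    have := shiftN_iterate_mem_of_image hX hmem' ν.length
    rw [shiftN_iterate_wordCat] at this
    exact ⟨hlen, this⟩
  exact subset_antisymm (key z z' h.subset) (key z' z h.symm.subset)

/-- prefix word of length `d` -/
def prefixWord {A : Type*} (x : ℕ → A) (d : ℕ) : List A := (List.range d).map x

lemma wordCat_prefixWord {A : Type*} (x : ℕ → A) (d : ℕ) :
    wordCat (prefixWord x d) (shiftN^[d] x) = x := by
  induction d generalizing x with
  | zero => rfl
  | succ d ih =>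
    have h1 : prefixWord x (d + 1) = x 0 :: prefixWord (shiftN x) d := by
      show (List.range (d+1)).map x = _
      rw [List.range_succ_eq_map, List.map_cons, List.map_map]
      rfl
    rw [h1, Function.iterate_succ_apply]
    show consSeq (x 0) (wordCat (prefixWord (shiftN x) d) (shiftN^[d] (shiftN x))) = x
    rw [ih (shiftN x), consSeq_shiftN]

lemma prefixWord_length {A : Type*} (x : ℕ → A) (d : ℕ) : (prefixWord x d).length = d := by
  simp [prefixWord]

lemma past_wordCat {A : Type*} {X : Set (ℕ → A)} (τ : List A) (z : ℕ → A) (m : ℕ) (μ : List A) :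
    μ ∈ past X m (wordCat τ z) ↔ μ ++ τ ∈ past X (m + τ.length) z := by
  constructor
  · rintro ⟨hlen, hmem⟩
    exact ⟨by simp [hlen], by rwa [wordCat_append]⟩
  · rintro ⟨hlen, hmem⟩
    rw [wordCat_append] at hmem
    refine ⟨?_, hmem⟩
    simp at hlen; omega

/-- Monotonicity of `∼_{k,l}` under the order `⪯`. -/
lemma sim_mono {A : Type*} {X : Set (ℕ → A)} (hX : shiftN '' X = X)
    {k₁ l₁ k₂ l₂ : ℕ} (hk : k₁ ≤ k₂) (hl : l₁ - k₁ ≤ l₂ - k₂) (hkl₁ : k₁ ≤ l₁) (hkl₂ : k₂ ≤ l₂)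
    {x y : ℕ → A}
    (h1 : ∀ i < k₂, x i = y i)
    (h2 : past X l₂ (shiftN^[k₂] x) = past X l₂ (shiftN^[k₂] y)) :
    (∀ i < k₁, x i = y i) ∧ past X l₁ (shiftN^[k₁] x) = past X l₁ (shiftN^[k₁] y) := by
  refine ⟨fun i hi => h1 i (lt_of_lt_of_le hi hk), ?_⟩
  set d := k₂ - k₁ with hd
  have hx : shiftN^[k₁] x = wordCat (prefixWord (shiftN^[k₁] x) d) (shiftN^[k₂] x) := by
    have := wordCat_prefixWord (shiftN^[k₁] x) d
    rw [← Function.iterate_add_apply, show d + k₁ = k₂ by omega] at this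
    exact this.symm
  have hy : shiftN^[k₁] y = wordCat (prefixWord (shiftN^[k₁] y) d) (shiftN^[k₂] y) := by
    have := wordCat_prefixWord (shiftN^[k₁] y) d
    rw [← Function.iterate_add_apply, show d + k₁ = k₂ by omega] at this
    exact this.symm
  have hτ : prefixWord (shiftN^[k₁] x) d = prefixWord (shiftN^[k₁] y) d := by
    unfold prefixWord
    refine List.map_congr_left ?_
    intro j hj
    rw [List.mem_range] at hj
    rw [shiftN_iterate_apply, shiftN_iterate_apply]
    exact h1 (j + k₁) (by omega)
  have hpast : past X (l₁ + d) (shiftN^[k₂] x) = past X (l₁ + d) (shiftN^[k₂] y) :=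
    past_mono hX (by omega) h2
  ext μ
  rw [hx, hy, ← hτ, past_wordCat, past_wordCat, prefixWord_length, hpast]

/-- The Sturmian subshift is invariant: `σ(X_α) = X_α`. -/
lemma sturmianN_shift_image (α : ℝ) : shiftN '' sturmianN α = sturmianN α := by
  apply subset_antisymm
  · rintro y ⟨x, hx, rfl⟩
    exact sturmianN_shift_mem hx
  · have hcompact : IsCompact (sturmianN α) := isClosed_closure.isCompact
    have hcl : IsClosed (shiftN '' sturmianN α) :=
      (hcompact.image continuous_shiftN).isClosed
    have hsub : {x : ℕ → Bool | ∃ t : ℝ, x = sturmianSeqN α t} ⊆ shiftN '' sturmianN α := by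
      rintro x ⟨t, rfl⟩
      refine ⟨sturmianSeqN α (t - α), subset_closure ⟨t - α, rfl⟩, ?_⟩
      funext i
      show sturmianCode α (t - α + (↑(i + 1) : ℝ) * α) = sturmianCode α (t + (i : ℝ) * α)
      congr 1
      push_cast
      ring
    exact closure_minimal hsub hcl

/-! ### The cover of a one-sided subshift -/

/-- The equivalence relation `∼_{k,l}` on a subshift `X`:
`x ∼_{k,l} x'` iff `x_{[0,k)} = x'_{[0,k)}` and `P_l(σ^k x) = P_l(σ^k x')`. -/
def coverSetoid {A : Type*} (X : Set (ℕ → A)) (k l : ℕ) : Setoid ↥X where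
  r x y := (∀ i < k, x.1 i = y.1 i) ∧
    past X l (shiftN^[k] x.1) = past X l (shiftN^[k] y.1)
  iseqv := ⟨fun _ => ⟨fun _ _ => rfl, rfl⟩,
    fun h => ⟨fun i hi => (h.1 i hi).symm, h.2.symm⟩,
    fun h h' => ⟨fun i hi => (h.1 i hi).trans (h'.1 i hi), h.2.trans h'.2⟩⟩

/-- The index set `I = {(k,l) ∈ ℕ × ℕ : k ≤ l}`. -/
def CoverIdx : Type := {p : ℕ × ℕ // p.1 ≤ p.2}

/-- The partial order `⪯` on the index set: `(k₁,l₁) ⪯ (k₂,l₂)` iff `k₁ ≤ k₂` and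
`l₁ - k₁ ≤ l₂ - k₂`. -/
def CoverIdx.le (p q : CoverIdx) : Prop :=
  p.1.1 ≤ q.1.1 ∧ p.1.2 - p.1.1 ≤ q.1.2 - q.1.1

/-- The cover `X̃` of a one-sided subshift `X`: the projective limit of the finite
quotients `X/∼_{k,l}` over the directed set `I`, realised as the set of coherent families
of equivalence classes.  A family is coherent if any representative at an index `q` is also
a representative at every index `p ⪯ q`. -/
def SubshiftCover {A : Type*} (X : Set (ℕ → A)) : Type _ :=
  {f : (p : CoverIdx) → Quotient (coverSetoid X p.1.1 p.1.2) //
    ∀ p q : CoverIdx, CoverIdx.le p q → ∀ x : ↥X,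
      f q = Quotient.mk (coverSetoid X q.1.1 q.1.2) x →
      f p = Quotient.mk (coverSetoid X p.1.1 p.1.2) x}

instance {A : Type*} [TopologicalSpace A] (X : Set (ℕ → A)) :
    TopologicalSpace (SubshiftCover X) := by
  unfold SubshiftCover; infer_instance

/-- The factor map `π : X̃ → X` (with values in the ambient space `A^ℕ`): the `n`-th letter
of `π(xt)` is the `n`-th letter of any `(n+1, n+1)`-representative of `xt`. -/
def coverProj {A : Type*} {X : Set (ℕ → A)} (f : SubshiftCover X) : ℕ → A := fun n =>
  Quotient.lift (fun x : ↥X => x.1 n)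
    (by intro a b h; obtain ⟨h1, -⟩ := h; exact h1 n (Nat.lt_succ_self n))
    (f.1 ⟨(n + 1, n + 1), le_refl _⟩)

/-- The shift `σ̃ : X̃ → X̃` induced on the cover: the `(k,l)`-coordinate of `σ̃(xt)` is the
class of `σ(x)` for a `(k+1, l+1)`-representative `x` of `xt`. -/
def coverShift {A : Type*} {X : Set (ℕ → A)} (hX : shiftN '' X = X)
    (f : SubshiftCover X) : SubshiftCover X :=
  ⟨fun p => Quotient.lift
      (fun x : ↥X => Quotient.mk (coverSetoid X p.1.1 p.1.2)
        ⟨shiftN x.1, shiftN_mem_of_image hX x.2⟩)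
      (by
        intro a b h
        obtain ⟨h1, h2⟩ := h
        apply Quotient.sound
        constructor
        · intro i hi
          exact h1 (i + 1) (Nat.succ_lt_succ hi)
        · show past X p.1.2 (shiftN^[p.1.1] (shiftN a.1)) =
            past X p.1.2 (shiftN^[p.1.1] (shiftN b.1))
          rw [← Function.iterate_succ_apply, ← Function.iterate_succ_apply]
          exact past_mono hX (Nat.le_succ p.1.2) h2)
      (f.1 ⟨(p.1.1 + 1, p.1.2 + 1), Nat.succ_le_succ p.2⟩),
    by
      intro p q hpq y hy
      obtain ⟨x, hx⟩ := Quotient.exists_rep (f.1 ⟨(q.1.1 + 1, q.1.2 + 1), Nat.succ_le_succ q.2⟩)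
      have hq' : f.1 ⟨(p.1.1 + 1, p.1.2 + 1), Nat.succ_le_succ p.2⟩ =
          Quotient.mk (coverSetoid X (p.1.1 + 1) (p.1.2 + 1)) x := by
        refine f.2 _ ⟨(q.1.1 + 1, q.1.2 + 1), Nat.succ_le_succ q.2⟩ ?_ x hx.symm
        refine ⟨Nat.succ_le_succ hpq.1, ?_⟩
        show p.1.2 + 1 - (p.1.1 + 1) ≤ q.1.2 + 1 - (q.1.1 + 1)
        have := hpq.2; omega
      beta_reduce at hy ⊢
      rw [← hx] at hy
      rw [hq']
      obtain ⟨h1, h2⟩ := Quotient.exact hy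
      exact Quotient.sound (sim_mono hX hpq.1 hpq.2 p.2 q.2 h1 h2)⟩

/-- The section `ι : X → X̃`, sending `x` to the family of its own classes. -/
def coverIota {A : Type*} {X : Set (ℕ → A)} (hX : shiftN '' X = X) (x : ↥X) :
    SubshiftCover X :=
  ⟨fun p => Quotient.mk (coverSetoid X p.1.1 p.1.2) x, by
    intro p q hpq y hy
    obtain ⟨h1, h2⟩ := Quotient.exact hy
    exact Quotient.sound (sim_mono hX hpq.1 hpq.2 p.2 q.2 h1 h2)⟩


/-! ### Letter frequencies -/

lemma sturmianCode_toNat {α : ℝ} (hα : α ∈ Ioo (0 : ℝ) 1) (t : ℝ) :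
    ((sturmianCode α t).toNat : ℝ) = (⌊t + α⌋ : ℝ) - ⌊t⌋ := by
  have h0 := Int.floor_add_fract t
  have h1 := Int.fract_nonneg t
  have h2 := Int.fract_lt_one t
  obtain ⟨h3, h4⟩ := hα
  by_cases h : 1 - α ≤ Int.fract t
  · have : ⌊t + α⌋ = ⌊t⌋ + 1 := by
      rw [Int.floor_eq_iff]; push_cast; constructor <;> linarith
    simp [sturmianCode, h, this]
  · have : ⌊t + α⌋ = ⌊t⌋ := by
      rw [Int.floor_eq_iff]; constructor <;> linarith
    simp [sturmianCode, h, this]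

lemma sum_sturmianSeqZ_toNat {α : ℝ} (hα : α ∈ Ioo (0 : ℝ) 1) (t : ℝ) (n : ℕ) :
    ∑ i ∈ Finset.range n, ((sturmianSeqZ α t i).toNat : ℝ) = (⌊t + n * α⌋ : ℝ) - ⌊t⌋ := by
  have h := Finset.sum_range_sub (fun i : ℕ => (⌊t + i * α⌋ : ℝ)) n
  simp only [Nat.cast_zero, zero_mul, add_zero] at h
  rw [← h]
  refine Finset.sum_congr rfl fun i _ => ?_
  rw [sturmianSeqZ, sturmianCode_toNat hα]
  push_cast
  ring_nf

/-- In every point of `Λ_α`, the number of ones in a prefix of length `n` differs from `n * α`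
by at most one. -/
lemma abs_sum_toNat_sub_le_one {α : ℝ} (hα : α ∈ Ioo (0 : ℝ) 1) (n : ℕ) {x : ℤ → Bool}
    (hx : x ∈ sturmianZ α) :
    |∑ i ∈ Finset.range n, ((x i).toNat : ℝ) - n * α| ≤ 1 := by
  have hcl : IsClosed {x : ℤ → Bool |
      |∑ i ∈ Finset.range n, ((x i).toNat : ℝ) - n * α| ≤ 1} := by
    refine isClosed_le ?_ continuous_const
    refine ((continuous_finsetSum _ fun i _ => ?_).sub continuous_const).abs
    exact (continuous_of_discreteTopology (f := fun b : Bool => (b.toNat : ℝ))).comp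
      (continuous_apply (i : ℤ))
  refine closure_minimal ?_ hcl hx
  rintro _ ⟨t, rfl⟩
  rw [mem_ofPred_eq, sum_sturmianSeqZ_toNat hα, abs_le]
  have h1 := Int.floor_le t
  have h2 := Int.lt_floor_add_one t
  have h3 := Int.floor_le (t + n * α)
  have h4 := Int.lt_floor_add_one (t + n * α)
  constructor <;> linarith

/-! ### Step functions with breakpoints in `ℤ + βℤ` -/

/-- The ring of functions generated by the indicators of `[b, ∞)` for `b ∈ ℤ + βℤ`. -/
def stepRing (β : ℝ) : Subring (ℝ → ℝ) :=
  Subring.closure {v | ∃ b ∈ ZplusAZ β, v = (Ici b).indicator 1}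

lemma indicator_Ici_mem_stepRing {β b : ℝ} (hb : b ∈ ZplusAZ β) :
    (Ici b).indicator (1 : ℝ → ℝ) ∈ stepRing β :=
  Subring.subset_closure ⟨b, hb, rfl⟩

lemma integral_indicator_Ici_mem {β b : ℝ} (hb : b ∈ ZplusAZ β) :
    ∫ t in (0 : ℝ)..1, (Ici b).indicator (1 : ℝ → ℝ) t ∈ ZplusAZ β := by
  rcases le_or_gt b 0 with h0 | h0
  · have : ∫ t in (0 : ℝ)..1, (Ici b).indicator (1 : ℝ → ℝ) t = ∫ t in (0 : ℝ)..1, (1 : ℝ) := by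
      refine intervalIntegral.integral_congr_Ioo_of_le zero_le_one fun t ht => ?_
      simp [h0.trans ht.1.le]
    rw [this]
    simpa using one_mem_ZplusAZ β
  rcases le_total 1 b with h1 | h1
  · have : ∫ t in (0 : ℝ)..1, (Ici b).indicator (1 : ℝ → ℝ) t = ∫ t in (0 : ℝ)..1, (0 : ℝ) := by
      refine intervalIntegral.integral_congr_Ioo_of_le zero_le_one fun t ht => ?_
      simp [ht.2.trans_le h1]
    rw [this]
    simp [zero_mem]
  · have : ∫ t in (0 : ℝ)..1, (Ici b).indicator (1 : ℝ → ℝ) t = 1 - b := by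
      rw [intervalIntegral.integral_of_le zero_le_one,
        MeasureTheory.integral_Ioc_eq_integral_Ioo,
        MeasureTheory.setIntegral_indicator measurableSet_Ici,
        show Ioo (0 : ℝ) 1 ∩ Ici b = Ico b 1 from ?_]
      · simp [h1]
      · ext t
        simp only [mem_inter_iff, mem_Ioo, mem_Ici, mem_Ico]
        exact ⟨fun h => ⟨h.2, h.1.2⟩, fun h => ⟨⟨h0.trans_le h.1, h.2⟩, h.1⟩⟩
    rw [this]
    exact sub_mem (one_mem_ZplusAZ β) hb

lemma stepRing_integral {β : ℝ} {v : ℝ → ℝ} (hv : v ∈ stepRing β) :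
    IntervalIntegrable v MeasureTheory.volume 0 1 ∧ ∫ t in (0 : ℝ)..1, v t ∈ ZplusAZ β := by
  rw [stepRing, Subring.mem_closure_iff] at hv
  induction hv using AddSubgroup.closure_induction with
  | mem v hv =>
    have hv' : v = 1 ∨ ∃ b ∈ ZplusAZ β, v = (Ici b).indicator 1 := by
      induction hv using Submonoid.closure_induction with
      | mem v hv => exact Or.inr hv
      | one => exact Or.inl rfl
      | mul v w _ _ hv hw =>
        rcases hv with rfl | ⟨b, hb, rfl⟩
        · simpa using hw
        rcases hw with rfl | ⟨c, hc, rfl⟩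
        · exact Or.inr ⟨b, hb, by simp⟩
        refine Or.inr ⟨max b c, ?_, ?_⟩
        · rcases max_choice b c with h | h <;> rwa [h]
        · rw [← Ici_inter_Ici, inter_indicator_one]
    rcases hv' with rfl | ⟨b, hb, rfl⟩
    · exact ⟨intervalIntegrable_const, by simpa using one_mem_ZplusAZ β⟩
    · refine ⟨?_, integral_indicator_Ici_mem hb⟩
      rw [intervalIntegrable_iff]
      exact (MeasureTheory.integrableOn_const (by simp)).indicator measurableSet_Ici
  | zero => exact ⟨intervalIntegrable_const, by simp [zero_mem]⟩
  | add v w _ _ hv hw =>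
    refine ⟨hv.1.add hw.1, ?_⟩
    simp only [Pi.add_apply]
    rw [intervalIntegral.integral_add hv.1 hw.1]
    exact add_mem hv.2 hw.2
  | neg v _ hv =>
    refine ⟨hv.1.neg, ?_⟩
    simp only [Pi.neg_apply]
    rw [intervalIntegral.integral_neg]
    exact neg_mem hv.2

/-- The sets whose indicator function agrees on `(0, 1)` with an element of `stepRing β`. -/
def IsStepSet (β : ℝ) (E : Set ℝ) : Prop :=
  ∃ v ∈ stepRing β, EqOn (E.indicator 1) v (Ioo 0 1)

lemma IsStepSet.compl {β : ℝ} {E : Set ℝ} (h : IsStepSet β E) : IsStepSet β Eᶜ := by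
  obtain ⟨v, hv, hE⟩ := h
  refine ⟨1 - v, sub_mem (one_mem _) hv, fun t ht => ?_⟩
  rw [indicator_compl, Pi.sub_apply, Pi.sub_apply, hE ht]

lemma IsStepSet.inter {β : ℝ} {E F : Set ℝ} (hE : IsStepSet β E) (hF : IsStepSet β F) :
    IsStepSet β (E ∩ F) := by
  obtain ⟨v, hv, hE⟩ := hE
  obtain ⟨w, hw, hF⟩ := hF
  refine ⟨v * w, mul_mem hv hw, fun t ht => ?_⟩
  rw [inter_indicator_one, Pi.mul_apply, Pi.mul_apply, hE ht, hF ht]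

lemma IsStepSet.union {β : ℝ} {E F : Set ℝ} (hE : IsStepSet β E) (hF : IsStepSet β F) :
    IsStepSet β (E ∪ F) := by
  simpa [compl_inter] using (hE.compl.inter hF.compl).compl

lemma isStepSet_empty (β : ℝ) : IsStepSet β ∅ :=
  ⟨0, zero_mem _, fun t _ => by simp⟩

lemma isStepSet_univ (β : ℝ) : IsStepSet β univ := by
  simpa using (isStepSet_empty β).compl

lemma exists_stepRing_eqOn_floor {β γ : ℝ} (hγ : γ ∈ ZplusAZ β) :
    ∃ v ∈ stepRing β, EqOn (fun t => (⌊t + γ⌋ : ℝ)) v (Ioo 0 1) := by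
  have hb : 1 + ⌊γ⌋ - γ ∈ ZplusAZ β :=
    sub_mem ⟨1 + ⌊γ⌋, 0, by push_cast; ring⟩ hγ
  refine ⟨(⌊γ⌋ : ℝ → ℝ) + (Ici (1 + ⌊γ⌋ - γ)).indicator 1,
    add_mem (intCast_mem _ _) (indicator_Ici_mem_stepRing hb), fun t ht => ?_⟩
  have h1 := Int.floor_le γ
  have h2 := Int.lt_floor_add_one γ
  obtain ⟨h3, h4⟩ := ht
  by_cases h : 1 + ⌊γ⌋ - γ ≤ t
  · have : ⌊t + γ⌋ = ⌊γ⌋ + 1 := by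
      rw [Int.floor_eq_iff]; push_cast; constructor <;> linarith
    simp [h, this]
  · have : ⌊t + γ⌋ = ⌊γ⌋ := by
      rw [Int.floor_eq_iff]; constructor <;> linarith
    simp [h, this]

lemma isStepSet_sturmianSeqZ_apply {β : ℝ} (hβ : β ∈ Ioo (0 : ℝ) 1) (i : ℤ) (a : Bool) :
    IsStepSet β {t | sturmianSeqZ β t i = a} := by
  have key : IsStepSet β {t | sturmianSeqZ β t i = true} := by
    obtain ⟨v, hv, hv'⟩ := exists_stepRing_eqOn_floor (β := β) (γ := (i + 1) * β)
      ⟨0, i + 1, by push_cast; ring⟩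
    obtain ⟨w, hw, hw'⟩ := exists_stepRing_eqOn_floor (β := β) (γ := i * β) ⟨0, i, by simp⟩
    refine ⟨v - w, sub_mem hv hw, fun t ht => ?_⟩
    have h := sturmianCode_toNat hβ (t + i * β)
    rw [Pi.sub_apply, ← hv' ht, ← hw' ht]
    simp only
    rw [show t + (i + 1) * β = t + i * β + β by ring, ← h]
    cases hc : sturmianCode β (t + i * β) <;> simp [sturmianSeqZ, hc]
  cases a
  · convert key.compl using 1
    ext t
    simp
  · exact key

/-- A compact set of sequences disjoint from a closed set can be separated from it by a set
whose preimage under the Sturmian coding is a step set. -/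
lemma exists_isStepSet_separating {β : ℝ} (hβ : β ∈ Ioo (0 : ℝ) 1) {K L : Set (ℤ → Bool)}
    (hK : IsCompact K) (hL : IsClosed L) (hKL : Disjoint K L) :
    ∃ D : Set (ℤ → Bool), K ⊆ D ∧ Disjoint D L ∧ IsStepSet β (sturmianSeqZ β ⁻¹' D) := by
  refine hK.induction_on
    (p := fun s => ∃ D, s ⊆ D ∧ Disjoint D L ∧ IsStepSet β (sturmianSeqZ β ⁻¹' D)) ?_ ?_ ?_ ?_
  · exact ⟨∅, subset_rfl, empty_disjoint L, by simpa using isStepSet_empty β⟩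
  · rintro s t hst ⟨D, h1, h2⟩
    exact ⟨D, hst.trans h1, h2⟩
  · rintro s t ⟨D, h1, h2, h3⟩ ⟨D', h1', h2', h3'⟩
    exact ⟨D ∪ D', union_subset_union h1 h1', h2.union_left h2', h3.union h3'⟩
  · intro x hx
    obtain ⟨I, u, hu, hsub⟩ := isOpen_pi_iff.1 hL.isOpen_compl x (hKL.notMem_of_mem_left hx)
    refine ⟨(I : Set ℤ).pi fun i => {x i}, mem_nhdsWithin_of_mem_nhds ?_, _, subset_rfl, ?_, ?_⟩
    · exact (isOpen_set_pi I.finite_toSet fun i _ => isOpen_discrete _).mem_nhds fun i _ => rfl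
    · rw [← subset_compl_iff_disjoint_right]
      refine (pi_mono fun i hi => ?_).trans hsub
      exact singleton_subset_iff.2 (hu i hi).2
    · clear hu hsub
      induction I using Finset.induction_on with
      | empty => simpa using isStepSet_univ β
      | insert i I _ ih =>
        convert (isStepSet_sturmianSeqZ_apply hβ i (x i)).inter ih using 1
        ext t
        simp

/-! ### Conjugacies -/

lemma sturmianSeqZ_mem (α t : ℝ) : sturmianSeqZ α t ∈ sturmianZ α :=
  subset_closure ⟨t, rfl⟩

lemma sturmianSeqZ_add_one (α t : ℝ) : sturmianSeqZ α (t + 1) = sturmianSeqZ α t := by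
  funext i
  rw [sturmianSeqZ, sturmianSeqZ, add_right_comm, sturmianCode, sturmianCode, Int.fract_add_one]

lemma sturmianShiftZ_iterate_apply {α : ℝ} (n : ℕ) (x : ↥(sturmianZ α)) (i : ℤ) :
    ((sturmianShiftZ α)^[n] x).1 i = x.1 (i + n) := by
  induction n generalizing i with
  | zero => simp
  | succ n ih =>
    rw [Function.iterate_succ_apply']
    change ((sturmianShiftZ α)^[n] x).1 (i + 1) = _
    rw [ih]
    push_cast
    ring_nf

lemma sturmianShiftZ_iterate_sturmianSeqZ (α t : ℝ) (n : ℕ) :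
    (sturmianShiftZ α)^[n] ⟨sturmianSeqZ α t, sturmianSeqZ_mem α t⟩ =
      ⟨sturmianSeqZ α (t + n * α), sturmianSeqZ_mem α _⟩ := by
  ext i
  rw [sturmianShiftZ_iterate_apply]
  simp only [sturmianSeqZ]
  push_cast
  ring_nf

lemma eq_of_forall_abs_nat_mul_sub_le {a b C : ℝ} (h : ∀ n : ℕ, |n * a - n * b| ≤ C) :
    a = b := by
  by_contra hab
  obtain ⟨n, hn⟩ := exists_nat_gt (C / |a - b|)
  rw [div_lt_iff₀ (abs_pos.2 (sub_ne_zero.2 hab))] at hn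
  have := h n
  rw [← mul_sub, abs_mul, Nat.abs_cast] at this
  linarith

/-- If `(Λ_α, σ_α)` is a factor of `(Λ_β, σ_β)`, then the frequency `α` belongs to
`ℤ + βℤ`. -/
lemma mem_ZplusAZ_of_semiconj {α β : ℝ} (hα : α ∈ Ioo (0 : ℝ) 1) (hβ : β ∈ Ioo (0 : ℝ) 1)
    {k : ↥(sturmianZ β) → ↥(sturmianZ α)} (hk : Continuous k)
    (hks : Function.Semiconj k (sturmianShiftZ β) (sturmianShiftZ α)) : α ∈ ZplusAZ β := by
  have hcl (a : Bool) : IsClosed (Subtype.val '' {y : ↥(sturmianZ β) | (k y).1 0 = a}) := by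
    refine (isClosed_closure.isClosedEmbedding_subtypeVal).isClosedMap _ ?_
    exact (isClosed_discrete {a}).preimage
      ((continuous_apply (0 : ℤ)).comp (continuous_subtype_val.comp hk))
  have hdisj : Disjoint (Subtype.val '' {y : ↥(sturmianZ β) | (k y).1 0 = true})
      (Subtype.val '' {y : ↥(sturmianZ β) | (k y).1 0 = false}) := by
    rw [disjoint_image_iff Subtype.val_injective, disjoint_left]
    intro y hy hy'
    simp_all
  obtain ⟨D, hD, hD', v, hv, hvD⟩ :=
    exists_isStepSet_separating hβ (hcl true).isCompact (hcl false) hdisj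
  have hmem (y : ↥(sturmianZ β)) : D.indicator (1 : (ℤ → Bool) → ℝ) y.1 = ((k y).1 0).toNat := by
    cases h : (k y).1 0
    · rw [indicator_of_notMem]
      · simp
      · exact hD'.notMem_of_mem_right ⟨y, h, rfl⟩
    · rw [indicator_of_mem (hD ⟨y, h, rfl⟩)]
      simp
  set u : ℝ → ℝ := (sturmianSeqZ β ⁻¹' D).indicator 1
  have hu_apply (t : ℝ) : u t = D.indicator (1 : (ℤ → Bool) → ℝ) (sturmianSeqZ β t) := rfl
  have hper : Function.Periodic u 1 := fun t => by
    rw [hu_apply, hu_apply, sturmianSeqZ_add_one]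
  obtain ⟨hvint, hvB⟩ := stepRing_integral hv
  have hint : IntervalIntegrable u MeasureTheory.volume 0 1 :=
    hvint.congr_uIoo fun t ht => (hvD (by simpa using ht)).symm
  have hintegral : ∫ t in (0 : ℝ)..1, u t = ∫ t in (0 : ℝ)..1, v t :=
    intervalIntegral.integral_congr_Ioo_of_le zero_le_one hvD
  have hbound (n : ℕ) (t : ℝ) : |∑ i ∈ Finset.range n, u (t + i * β) - n * α| ≤ 1 := by
    have h := abs_sum_toNat_sub_le_one hα n (k ⟨_, sturmianSeqZ_mem β t⟩).2
    convert h using 4 with i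
    rw [hu_apply, hmem ⟨_, sturmianSeqZ_mem β _⟩, ← sturmianShiftZ_iterate_sturmianSeqZ,
      (hks.iterate_right i).eq, sturmianShiftZ_iterate_apply, zero_add]
  have hint' (i : ℕ) :
      IntervalIntegrable (fun t => u (t + i * β)) MeasureTheory.volume 0 1 :=
    by simpa using (hper.intervalIntegrable₀ one_ne_zero hint (0 + i * β)
      (1 + i * β)).comp_add_right (i * β)
  have havg : ∫ t in (0 : ℝ)..1, u t = α := by
    refine eq_of_forall_abs_nat_mul_sub_le (C := 1) fun n => ?_
    have h1 (i : ℕ) : ∫ t in (0 : ℝ)..1, u (t + i * β) = ∫ t in (0 : ℝ)..1, u t := by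
      rw [intervalIntegral.integral_comp_add_right, zero_add, add_comm 1,
        hper.intervalIntegral_add_eq _ 0, zero_add]
    have h2 : ∫ t in (0 : ℝ)..1, (∑ i ∈ Finset.range n, u (t + i * β) - n * α) =
        n * (∫ t in (0 : ℝ)..1, u t) - n * α := by
      have h3 : IntervalIntegrable (fun t => ∑ i ∈ Finset.range n, u (t + i * β))
          MeasureTheory.volume 0 1 := by
        simpa only [Finset.sum_fn] using
          IntervalIntegrable.sum (Finset.range n) fun i _ => hint' i
      rw [intervalIntegral.integral_sub h3 intervalIntegrable_const, intervalIntegral.integral_finsetSum fun i _ => hint' i]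
      simp [h1]
    rw [← h2]
    have := intervalIntegral.norm_integral_le_of_norm_le_const (a := (0 : ℝ)) (b := 1) (C := 1)
      (f := fun t => ∑ i ∈ Finset.range n, u (t + i * β) - n * α) fun t _ => hbound n t
    simpa using this
  rw [← havg, hintegral]
  exact hvB

lemma eq_or_eq_one_sub_of_mem_ZplusAZ {α β : ℝ} (hα : Irrational α)
    (hαm : α ∈ Ioo (0 : ℝ) 1) (hβm : β ∈ Ioo (0 : ℝ) 1)
    (hαβ : α ∈ ZplusAZ β) (hβα : β ∈ ZplusAZ α) : α = β ∨ α = 1 - β := by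
  obtain ⟨m, n, h⟩ := hαβ
  obtain ⟨p, q, h'⟩ := hβα
  have hnq : n * q = 1 := by
    by_contra hne
    have h1 : α * ((1 - n * q : ℤ) : ℝ) = ((m + n * p : ℤ) : ℝ) := by
      push_cast
      linear_combination h + n * h'
    exact (hα.mul_intCast (sub_ne_zero.2 (Ne.symm hne))).ne_int _ h1
  obtain ⟨h0, h1⟩ := hαm
  obtain ⟨h2, h3⟩ := hβm
  rcases Int.eq_one_or_neg_one_of_mul_eq_one hnq with rfl | rfl
  · left
    have hm1 : (-1 : ℝ) < m := by push_cast at h; linarith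
    have hm2 : (m : ℝ) < 1 := by push_cast at h; linarith
    have hm1' : -1 < m := by exact_mod_cast hm1
    have hm2' : m < 1 := by exact_mod_cast hm2
    obtain rfl : m = 0 := by omega
    simpa using h
  · right
    have hm1 : (0 : ℝ) < m := by push_cast at h; linarith
    have hm2 : (m : ℝ) < 2 := by push_cast at h; linarith
    have hm1' : 0 < m := by exact_mod_cast hm1
    have hm2' : m < 2 := by exact_mod_cast hm2
    obtain rfl : m = 1 := by omega
    push_cast at h
    linarith

/-! ### The symmetry between `α` and `1 - α` -/

/-- Exchanging the two symbols. -/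
def flipHomeo : (ℤ → Bool) ≃ₜ (ℤ → Bool) where
  toFun x i := !(x i)
  invFun x i := !(x i)
  left_inv x := by simp
  right_inv x := by simp
  continuous_toFun := continuous_pi fun i =>
    (continuous_of_discreteTopology (f := Bool.not)).comp (continuous_apply i)
  continuous_invFun := continuous_pi fun i =>
    (continuous_of_discreteTopology (f := Bool.not)).comp (continuous_apply i)

lemma eventually_sturmianCode_one_sub_neg_sub (α r : ℝ) :
    ∀ᶠ ε in nhdsWithin (0 : ℝ) (Ioi 0), sturmianCode (1 - α) (-r - ε) = !(sturmianCode α r) := by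
  have h1 := Int.fract_nonneg r
  have h2 := Int.fract_lt_one r
  have hfr : ∀ ε ∈ Ioo 0 (1 - Int.fract r), Int.fract (-r - ε) = 1 - Int.fract r - ε := by
    rintro ε ⟨h3, h4⟩
    rw [Int.fract_eq_iff]
    refine ⟨by linarith, by linarith, -⌊r⌋ - 1, ?_⟩
    have := Int.floor_add_fract r
    push_cast
    linarith
  have hpos : 0 < 1 - Int.fract r := by linarith
  by_cases h : 1 - α ≤ Int.fract r
  · filter_upwards [Ioo_mem_nhdsGT hpos] with ε hε
    have : ¬ α ≤ 1 - Int.fract r - ε := by linarith [hε.1]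
    simp [sturmianCode, hfr ε hε, h, this]
  · have hpos' : 0 < 1 - α - Int.fract r := by linarith
    filter_upwards [Ioo_mem_nhdsGT hpos, Ioo_mem_nhdsGT hpos'] with ε hε hε'
    have : α ≤ 1 - Int.fract r - ε := by linarith [hε'.2]
    simp [sturmianCode, hfr ε hε, h, this]

lemma flipHomeo_mem {α : ℝ} {x : ℤ → Bool} (hx : x ∈ sturmianZ α) :
    flipHomeo x ∈ sturmianZ (1 - α) := by
  have hcl : IsClosed (flipHomeo ⁻¹' sturmianZ (1 - α)) :=
    isClosed_closure.preimage flipHomeo.continuous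
  refine closure_minimal ?_ hcl hx
  rintro _ ⟨t, rfl⟩
  refine mem_closure_of_tendsto (f := fun ε => sturmianSeqZ (1 - α) (-t - ε))
    (b := nhdsWithin (0 : ℝ) (Ioi 0)) ?_ (Filter.Eventually.of_forall fun ε => ⟨_, rfl⟩)
  rw [tendsto_pi_nhds]
  intro i
  refine Filter.Tendsto.congr' ?_ tendsto_const_nhds
  filter_upwards [eventually_sturmianCode_one_sub_neg_sub α (t + i * α)] with ε hε
  change (!(sturmianCode α (t + i * α))) = _
  rw [← hε, sturmianSeqZ, sturmianCode, sturmianCode,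
    show -t - ε + i * (1 - α) = -(t + i * α) - ε + i by ring, Int.fract_add_intCast]

lemma exists_conjugacy_one_sub (α : ℝ) :
    ∃ h : ↥(sturmianZ α) ≃ₜ ↥(sturmianZ (1 - α)),
      ∀ x : ↥(sturmianZ α), h (sturmianShiftZ α x) = sturmianShiftZ (1 - α) (h x) := by
  have hmem (x : ℤ → Bool) : x ∈ sturmianZ α ↔ flipHomeo x ∈ sturmianZ (1 - α) := by
    refine ⟨flipHomeo_mem, fun h => ?_⟩
    have := flipHomeo_mem h
    rw [sub_sub_cancel] at this
    convert this
    exact (flipHomeo.symm_apply_apply x).symm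
  exact ⟨flipHomeo.subtype hmem, fun x => rfl⟩

/-- Two two-sided Sturmian subshifts `(Λ_α, σ_α)` and `(Λ_β, σ_β)` are
conjugate if and only if `α = β` or `α = 1 - β`. -/
theorem sturmian_two_sided_conjugacy_iff (α β : ℝ) (hα : Irrational α) (hβ : Irrational β)
    (hαm : α ∈ Set.Ioo (0 : ℝ) 1) (hβm : β ∈ Set.Ioo (0 : ℝ) 1) :
    (∃ h : ↥(sturmianZ α) ≃ₜ ↥(sturmianZ β),
        ∀ x : ↥(sturmianZ α), h (sturmianShiftZ α x) = sturmianShiftZ β (h x))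
      ↔ (α = β ∨ α = 1 - β) := by
  constructor
  · rintro ⟨h, hh⟩
    have hsemi : Function.Semiconj h (sturmianShiftZ α) (sturmianShiftZ β) := hh
    have hsemi' : Function.Semiconj h.symm (sturmianShiftZ β) (sturmianShiftZ α) :=
      hsemi.inverse_left h.symm_apply_apply h.apply_symm_apply
    exact eq_or_eq_one_sub_of_mem_ZplusAZ hα hαm hβm
      (mem_ZplusAZ_of_semiconj hαm hβm h.symm.continuous hsemi')
      (mem_ZplusAZ_of_semiconj hβm hαm h.continuous hsemi)
  · rintro (rfl | h)
    · exact ⟨Homeomorph.refl _, fun x => rfl⟩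
    · obtain rfl : β = 1 - α := by linarith
      exact exists_conjugacy_one_sub α

end
end

section
/- Let α, β ∈ (0,1) be irrational. There exists an order isomorphism of ordered abelian groups from ℤ + αℤ onto ℤ + βℤ sending 1 to 1 if and only if α = β or α = 1 − β. -/
noncomputable section

open Set

/-- An order-preserving additive equivalence between additive subgroups of `ℝ` containing `1`
which fixes `1` is the identity on underlying real numbers. -/
lemma AddSubgroup.coe_orderIso_eq_of_map_one {G H : AddSubgroup ℝ} (hG : (1 : ℝ) ∈ G)
    (hH : (1 : ℝ) ∈ H) (e : G ≃+ H) (he : ∀ x y : G, x ≤ y ↔ e x ≤ e y)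
    (h1 : e ⟨1, hG⟩ = ⟨1, hH⟩) (x : G) : ((e x : H) : ℝ) = x := by
  have hmap (p : ℤ) : e (p • ⟨1, hG⟩) = p • ⟨1, hH⟩ := by rw [map_zsmul, h1]
  have hle (d : ℕ) (p : ℤ) : (d : ℝ) * x ≤ p ↔ (d : ℝ) * (e x : H) ≤ p := by
    have h := he (d • x) (p • ⟨1, hG⟩)
    rw [hmap, map_nsmul, ← Subtype.coe_le_coe, ← Subtype.coe_le_coe] at h
    simpa using h
  have hge (d : ℕ) (p : ℤ) : (p : ℝ) ≤ d * x ↔ (p : ℝ) ≤ d * (e x : H) := by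
    have h := he (p • ⟨1, hG⟩) (d • x)
    rw [hmap, map_nsmul, ← Subtype.coe_le_coe, ← Subtype.coe_le_coe] at h
    simpa using h
  have hq (q : ℚ) : (q : ℝ) = q.num / q.den := Rat.cast_def q
  have hd (q : ℚ) : (0 : ℝ) < q.den := by exact_mod_cast q.den_pos
  rcases lt_trichotomy ((e x : H) : ℝ) x with h | h | h
  · obtain ⟨q, hq1, hq2⟩ := exists_rat_btwn h
    rw [hq, lt_div_iff₀' (hd q)] at hq1
    rw [hq, div_lt_iff₀' (hd q)] at hq2
    exact absurd ((hge _ _).1 hq2.le) hq1.not_ge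
  · exact h
  · obtain ⟨q, hq1, hq2⟩ := exists_rat_btwn h
    rw [hq, lt_div_iff₀' (hd q)] at hq1
    rw [hq, div_lt_iff₀' (hd q)] at hq2
    exact absurd ((hle _ _).1 hq1.le) hq2.not_ge

lemma self_mem_ZplusAZ (α : ℝ) : α ∈ ZplusAZ α := ⟨0, 1, by norm_num⟩

lemma ZplusAZ_le_of_mem {α β : ℝ} (h : α ∈ ZplusAZ β) : ZplusAZ α ≤ ZplusAZ β := by
  rintro x ⟨m, n, rfl⟩
  simpa using add_mem (zsmul_mem (one_mem_ZplusAZ β) m) (zsmul_mem h n)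

/-- For `α` irrational, `α, β ∈ (0, 1)`, the groups `ℤ + αℤ` and `ℤ + βℤ` coincide as subsets
of `ℝ` iff `α = β` or `α = 1 - β`. -/
lemma ZplusAZ_eq_iff {α β : ℝ} (hα : Irrational α) (hαm : α ∈ Set.Ioo (0 : ℝ) 1)
    (hβm : β ∈ Set.Ioo (0 : ℝ) 1) : ZplusAZ α = ZplusAZ β ↔ α = β ∨ α = 1 - β := by
  obtain ⟨hα0, hα1⟩ := hαm
  obtain ⟨hβ0, hβ1⟩ := hβm
  constructor
  · intro h
    obtain ⟨m, n, hmn⟩ : α ∈ ZplusAZ β := h ▸ self_mem_ZplusAZ α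
    obtain ⟨m', n', hmn'⟩ : β ∈ ZplusAZ α := h ▸ self_mem_ZplusAZ β
    have hnn : n * n' = 1 := by
      by_contra hne
      have hne' : (1 - n * n' : ℝ) ≠ 0 := by
        rw [sub_ne_zero]
        exact_mod_cast Ne.symm hne
      refine hα ⟨(m + n * m') / (1 - n * n'), ?_⟩
      push_cast
      rw [div_eq_iff hne']
      linear_combination -hmn - n * hmn'
    rcases Int.eq_one_or_neg_one_of_mul_eq_one hnn with rfl | rfl
    · left
      have hm1 : m < 1 := by exact_mod_cast (show (m : ℝ) < 1 by push_cast at hmn; linarith)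
      have hm2 : -1 < m := by exact_mod_cast (show (-1 : ℝ) < m by push_cast at hmn; linarith)
      obtain rfl : m = 0 := by omega
      simpa using hmn
    · right
      have hm1 : m < 2 := by exact_mod_cast (show (m : ℝ) < 2 by push_cast at hmn; linarith)
      have hm2 : 0 < m := by exact_mod_cast (show (0 : ℝ) < m by push_cast at hmn; linarith)
      obtain rfl : m = 1 := by omega
      push_cast at hmn
      linarith
  · rintro (rfl | rfl)
    · rfl
    · exact le_antisymm (ZplusAZ_le_of_mem ⟨1, -1, by push_cast; ring⟩)
        (ZplusAZ_le_of_mem ⟨1, -1, by push_cast; ring⟩)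

/-- There is an order isomorphism of ordered abelian groups
`ℤ + αℤ → ℤ + βℤ` sending `1` to `1` if and only if `α = β` or `α = 1 - β`. -/
theorem ZplusAZ_pointed_orderIso_iff (α β : ℝ) (hα : Irrational α) (hβ : Irrational β)
    (hαm : α ∈ Set.Ioo (0 : ℝ) 1) (hβm : β ∈ Set.Ioo (0 : ℝ) 1) :
    (∃ e : ↥(ZplusAZ α) ≃+ ↥(ZplusAZ β),
        (∀ x y : ↥(ZplusAZ α), x ≤ y ↔ e x ≤ e y) ∧
        e ⟨1, one_mem_ZplusAZ α⟩ = ⟨1, one_mem_ZplusAZ β⟩)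
      ↔ (α = β ∨ α = 1 - β) := by
  rw [← ZplusAZ_eq_iff hα hαm hβm]
  constructor
  · rintro ⟨e, he, h1⟩
    have hid := AddSubgroup.coe_orderIso_eq_of_map_one _ _ e he h1
    apply le_antisymm
    · intro x hx
      exact (congrArg (· ∈ ZplusAZ β) (hid ⟨x, hx⟩)).mp (e ⟨x, hx⟩).2
    · intro y hy
      have h := hid (e.symm ⟨y, hy⟩)
      rw [e.apply_symm_apply] at h
      exact (congrArg (· ∈ ZplusAZ α) h).mpr (e.symm ⟨y, hy⟩).2
  · intro h
    exact ⟨AddEquiv.addSubgroupCongr h, fun _ _ => Iff.rfl, rfl⟩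

end
end

section
/- Let α, β ∈ (0,1) be irrational. The ordered abelian groups ℤ + αℤ and ℤ + βℤ are order isomorphic (not necessarily preserving the element 1) if and only if α ∼ β, i.e. α and β are equivalent irrationals. -/
noncomputable section

open Set

lemma intCast_add_intCast_mul_irrational_inj {β : ℝ} (hβ : Irrational β) {m n m' n' : ℤ}
    (h : (m : ℝ) + n * β = m' + n' * β) : m = m' ∧ n = n' := by
  have hn : n = n' := by
    by_contra hne
    have hsub : ((n - n' : ℤ) : ℝ) * β = ((m' - m : ℤ) : ℝ) := by
      push_cast
      linarith
    exact (hβ.intCast_mul (sub_ne_zero.mpr hne)).ne_int _ hsub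
  subst hn
  exact ⟨by exact_mod_cast add_right_cancel h, rfl⟩

/-- Two real numbers defining the same cut in `ℚ`, relative to the units `u` and `v`,
are proportional to these units. -/
lemma mul_eq_mul_of_int_cut {u v x y : ℝ} (hu : 0 < u) (hv : 0 < v)
    (h : ∀ p q : ℤ, p * u ≤ q * x ↔ p * v ≤ q * y) : x * v = y * u := by
  have hcut : ∀ r : ℚ, (r : ℝ) ≤ x / u ↔ (r : ℝ) ≤ y / v := by
    intro r
    have hd : (0 : ℝ) < (r.den : ℤ) := by exact_mod_cast r.den_pos
    have hr : (r : ℝ) = (r.num : ℝ) / ((r.den : ℤ) : ℝ) := by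
      rw [Int.cast_natCast]
      exact Rat.cast_def r
    rw [hr, div_le_div_iff₀ hd hu, div_le_div_iff₀ hd hv, mul_comm x, mul_comm y]
    exact h r.num r.den
  have heq : x / u = y / v := le_antisymm
    (le_of_forall_rat_lt_imp_le fun r hr => (hcut r).1 hr.le)
    (le_of_forall_rat_lt_imp_le fun r hr => (hcut r).2 hr.le)
  rwa [div_eq_div_iff hu.ne' hv.ne'] at heq

/-- An order isomorphism between `ℤ + αℤ` and `ℤ + βℤ` is multiplication by a positive real. -/
lemma ZplusAZ_orderIso_eq_mul {α β : ℝ} (e : ↥(ZplusAZ α) ≃+ ↥(ZplusAZ β))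
    (he : ∀ x y : ↥(ZplusAZ α), x ≤ y ↔ e x ≤ e y) :
    ∃ t : ℝ, 0 < t ∧ ∀ x : ↥(ZplusAZ α), (e x : ℝ) = t * x := by
  set i : ↥(ZplusAZ α) := ⟨1, one_mem_ZplusAZ α⟩
  have hcomb : ∀ (x : ↥(ZplusAZ α)) (p : ℤ), ((e (p • x) : ↥(ZplusAZ β)) : ℝ) = p * (e x : ℝ) := by
    intro x p
    rw [map_zsmul, AddSubgroup.coe_zsmul, zsmul_eq_mul]
  have hpos : (0 : ℝ) < (e i : ℝ) := by
    have hlt : ¬ i ≤ 0 := by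
      intro h
      have h1 : (1 : ℝ) ≤ 0 := h
      norm_num at h1
    rw [he, map_zero, not_le] at hlt
    exact hlt
  refine ⟨(e i : ℝ), hpos, fun x => ?_⟩
  have hcut := mul_eq_mul_of_int_cut (x := (x : ℝ)) (y := (e x : ℝ)) one_pos hpos
    fun p q => by
      have hpq := he (p • i) (q • x)
      rw [← Subtype.coe_le_coe, ← Subtype.coe_le_coe, hcomb, hcomb, AddSubgroup.coe_zsmul,
        AddSubgroup.coe_zsmul, zsmul_eq_mul, zsmul_eq_mul] at hpq
      exact hpq
  linarith

lemma IrrationalEquiv.of_orderIso {α β : ℝ} (hβ : Irrational β)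
    (e : ↥(ZplusAZ α) ≃+ ↥(ZplusAZ β))
    (he : ∀ x y : ↥(ZplusAZ α), x ≤ y ↔ e x ≤ e y) : IrrationalEquiv α β := by
  obtain ⟨t, ht, hmul⟩ := ZplusAZ_orderIso_eq_mul e he
  obtain ⟨m, n, hmn⟩ := (e ⟨1, one_mem_ZplusAZ α⟩).2
  obtain ⟨p, q, hpq⟩ := (e ⟨α, self_mem_ZplusAZ α⟩).2
  rw [hmul] at hmn hpq
  obtain ⟨⟨_, d, c, rfl⟩, hx⟩ := e.surjective ⟨1, one_mem_ZplusAZ β⟩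
  obtain ⟨⟨_, b, a, rfl⟩, hy⟩ := e.surjective ⟨β, self_mem_ZplusAZ β⟩
  have hone := congrArg Subtype.val hx
  have hbeta := congrArg Subtype.val hy
  rw [hmul] at hone hbeta
  dsimp only at hmn hpq hone hbeta
  obtain ⟨h₁, h₂⟩ := intCast_add_intCast_mul_irrational_inj hβ
    (m := d * m + c * p) (n := d * n + c * q) (m' := 1) (n' := 0) (by
      push_cast
      linear_combination hone - d * hmn - c * hpq)
  obtain ⟨h₃, h₄⟩ := intCast_add_intCast_mul_irrational_inj hβ
    (m := b * m + a * p) (n := b * n + a * q) (m' := 0) (n' := 1) (by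
      push_cast
      linear_combination hbeta - b * hmn - a * hpq)
  refine ⟨a, b, c, d, Int.isUnit_iff.mp (IsUnit.of_mul_eq_one (m * q - n * p) ?_), ?_⟩
  · linear_combination (b * n + a * q) * h₁ + h₄ - (b * m + a * p) * h₂
  · have hD : (c : ℝ) * α + d ≠ 0 := by
      intro h0
      have : t * ((d : ℝ) + c * α) = 0 := by rw [add_comm, h0, mul_zero]
      linarith
    rw [eq_div_iff hD]
    linear_combination (a * α + b) * hone - (c * α + d) * hbeta

/-- Multiplication by `t`, as an isomorphism between additive subgroups of `ℝ`
which it matches. -/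
def addSubgroupMulEquiv {G H : AddSubgroup ℝ} {t : ℝ} (ht : t ≠ 0)
    (hG : ∀ x ∈ G, t * x ∈ H) (hH : ∀ y ∈ H, t⁻¹ * y ∈ G) : ↥G ≃+ ↥H where
  toFun x := ⟨t * x, hG x x.2⟩
  invFun y := ⟨t⁻¹ * y, hH y y.2⟩
  left_inv x := Subtype.ext (inv_mul_cancel_left₀ ht _)
  right_inv y := Subtype.ext (mul_inv_cancel_left₀ ht _)
  map_add' x y := Subtype.ext (mul_add t x y)

lemma AddSubgroup.abs_mul_mem {G : AddSubgroup ℝ} {t x : ℝ} (h : t * x ∈ G) : |t| * x ∈ G := by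
  rcases abs_choice t with ht | ht
  · rwa [ht]
  · rw [ht, neg_mul]
    exact G.neg_mem h

lemma IrrationalEquiv.exists_orderIso {α β : ℝ} (hβ : β ≠ 0) (h : IrrationalEquiv α β) :
    ∃ e : ↥(ZplusAZ α) ≃+ ↥(ZplusAZ β), ∀ x y : ↥(ZplusAZ α), x ≤ y ↔ e x ≤ e y := by
  obtain ⟨a, b, c, d, hdet, hab⟩ := h
  have hD : (c : ℝ) * α + d ≠ 0 := by
    intro h0
    rw [h0, div_zero] at hab
    exact hβ hab
  set D : ℝ := (c : ℝ) * α + d with hDdef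
  have hDβ : D * β = a * α + b := by rw [hab, mul_div_cancel₀ _ hD]
  have hsq : ((a : ℝ) * d - b * c) * (a * d - b * c) = 1 := by
    rcases hdet with h | h
    all_goals
      have h' := congrArg (Int.cast (R := ℝ)) h
      push_cast at h'
      rw [h']
      norm_num
  have hto : ∀ x ∈ ZplusAZ α, |D⁻¹| * x ∈ ZplusAZ β := by
    rintro _ ⟨m, n, rfl⟩
    refine AddSubgroup.abs_mul_mem
      ⟨(a * d - b * c) * (m * a - n * b), (a * d - b * c) * (n * d - m * c), ?_⟩
    rw [inv_mul_eq_iff_eq_mul₀ hD]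
    push_cast
    linear_combination (-(m + n * α)) * hsq -
      ((a : ℝ) * d - b * c) * (n * d - m * c) * hDβ -
      ((a : ℝ) * d - b * c) * (m * a - n * b) * hDdef
  have hof : ∀ y ∈ ZplusAZ β, |D⁻¹|⁻¹ * y ∈ ZplusAZ α := by
    rintro _ ⟨k, l, rfl⟩
    rw [abs_inv, inv_inv]
    refine AddSubgroup.abs_mul_mem ⟨k * d + l * b, k * c + l * a, ?_⟩
    push_cast
    linear_combination l * hDβ + k * hDdef
  have hpos : 0 < |D⁻¹| := abs_pos.mpr (inv_ne_zero hD)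
  exact ⟨addSubgroupMulEquiv hpos.ne' hto hof, fun x y => (mul_le_mul_iff_right₀ hpos).symm⟩

/-- The ordered abelian groups `ℤ + αℤ` and `ℤ + βℤ` are order isomorphic
(not necessarily preserving `1`) if and only if `α` and `β` are equivalent irrationals. -/
theorem ZplusAZ_orderIso_iff (α β : ℝ) (hα : Irrational α) (hβ : Irrational β)
    (hαm : α ∈ Set.Ioo (0 : ℝ) 1) (hβm : β ∈ Set.Ioo (0 : ℝ) 1) :
    (∃ e : ↥(ZplusAZ α) ≃+ ↥(ZplusAZ β),
        ∀ x y : ↥(ZplusAZ α), x ≤ y ↔ e x ≤ e y)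
      ↔ IrrationalEquiv α β :=
  ⟨fun ⟨e, he⟩ => IrrationalEquiv.of_orderIso hβ e he, fun h => h.exists_orderIso hβ.ne_zero⟩

end
end
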